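/- arXiv:2305.07782 — 2 statements merged into one kernel-verified Lean document; each statement's English description precedes it below -/
import Mathlib

section
/- Let (Ω, P) be a probability space, r : Ω → ℝ a random variable with r² integrable, and θ : Ω → ℝ a random variable whose law is the uniform distribution on [0, 2π), with r and θ independent. Define y : Ω → ℝ² by y(ω) = r(ω)·(cos θ(ω), sin θ(ω)). Then for every unit vector u ∈ ℝ², E[⟨y,u⟩²] = E[‖y‖²]/2. -/
open Real MeasureTheory ProbabilityTheory RealInnerProductSpace

/-- Averaging the square of a linear combination of cosine and sine over a full period. -/
lemma intervalIntegral_sq_cos_mul_add_sin_mul (a b : ℝ) :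
    ∫ x in (0 : ℝ)..(2 * π), (cos x * a + sin x * b) ^ 2 = π * (a ^ 2 + b ^ 2) := by
  have expand : ∀ x : ℝ, (cos x * a + sin x * b) ^ 2
      = a ^ 2 * cos x ^ 2 + b ^ 2 * sin x ^ 2 + 2 * a * b * (sin x * cos x) := fun x => by ring
  simp_rw [expand]
  rw [intervalIntegral.integral_add, intervalIntegral.integral_add,
    intervalIntegral.integral_const_mul, intervalIntegral.integral_const_mul,
    intervalIntegral.integral_const_mul, integral_cos_sq, integral_sin_sq, integral_sin_mul_cos₁]
  · simp
    ring
  all_goals exact Continuous.intervalIntegrable (by fun_prop) _ _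

/-- The expectation of `(a cos θ + b sin θ)²` for `θ` uniform on `[0, 2π)`. -/
lemma integral_sq_cos_mul_add_sin_mul_of_uniform {Ω : Type*} [MeasurableSpace Ω] {P : Measure Ω}
    {θ : Ω → ℝ} (hθ : Measurable θ)
    (hlaw : Measure.map θ P
      = (ENNReal.ofReal (1 / (2 * π))) • volume.restrict (Set.Ico 0 (2 * π))) (a b : ℝ) :
    ∫ ω, (cos (θ ω) * a + sin (θ ω) * b) ^ 2 ∂P = (a ^ 2 + b ^ 2) / 2 := by
  have hcont : Continuous fun x : ℝ => (cos x * a + sin x * b) ^ 2 := by fun_prop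
  rw [← integral_map (f := fun x => (cos x * a + sin x * b) ^ 2) hθ.aemeasurable
      hcont.aestronglyMeasurable, hlaw, integral_smul_measure, integral_Ico_eq_integral_Ioc,
    ← intervalIntegral.integral_of_le (by positivity), intervalIntegral_sq_cos_mul_add_sin_mul,
    ENNReal.toReal_ofReal (by positivity), smul_eq_mul]
  field_simp

/-- **Equation (38) in the proof of Lemma 1.** Let `y = r·(cos θ, sin θ)` where `r²` is
integrable, `θ` is uniformly distributed on `[0, 2π)`, and `r, θ` are independent. Then
for every unit vector `u ∈ ℝ²`, `E[⟨y,u⟩²] = E[‖y‖²]/2`. -/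
theorem expected_sq_inner_eq_half_energy
    {Ω : Type*} [MeasurableSpace Ω] (P : Measure Ω) [IsProbabilityMeasure P]
    (r θ : Ω → ℝ) (hr : Measurable r) (hθ : Measurable θ)
    (hr2 : Integrable (fun ω => (r ω) ^ 2) P)
    (hlaw : Measure.map θ P
      = (ENNReal.ofReal (1 / (2 * π))) • volume.restrict (Set.Ico 0 (2 * π)))
    (hindep : IndepFun r θ P)
    (y : Ω → EuclideanSpace ℝ (Fin 2))
    (hy : ∀ ω, y ω
      = r ω • (WithLp.equiv 2 (Fin 2 → ℝ)).symm ![Real.cos (θ ω), Real.sin (θ ω)])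
    (u : EuclideanSpace ℝ (Fin 2)) (hu : ‖u‖ = 1) :
    ∫ ω, ⟪y ω, u⟫ ^ 2 ∂P = (∫ ω, ‖y ω‖ ^ 2 ∂P) / 2 := by
  have hinner : ∀ ω, ⟪y ω, u⟫ ^ 2 = r ω ^ 2 * (cos (θ ω) * u 0 + sin (θ ω) * u 1) ^ 2 := by
    intro ω
    simp [hy, PiLp.inner_apply, Fin.sum_univ_two]
    ring
  have hnorm : ∀ ω, ‖y ω‖ ^ 2 = r ω ^ 2 := by
    intro ω
    simp [hy, norm_smul, mul_pow, EuclideanSpace.norm_sq_eq, Fin.sum_univ_two]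
  have hu' : u 0 ^ 2 + u 1 ^ 2 = 1 := by
    simpa [hu, Fin.sum_univ_two] using (EuclideanSpace.norm_sq_eq u).symm
  have hind : IndepFun (fun ω => r ω ^ 2)
      (fun ω => (cos (θ ω) * u 0 + sin (θ ω) * u 1) ^ 2) P :=
    hindep.comp (φ := fun x => x ^ 2) (ψ := fun x => (cos x * u 0 + sin x * u 1) ^ 2)
      (by fun_prop) (by fun_prop)
  simp_rw [hinner, hnorm]
  rw [hind.integral_fun_mul_eq_mul_integral (by fun_prop) (by fun_prop),
    integral_sq_cos_mul_add_sin_mul_of_uniform hθ hlaw, hu']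
  ring
end

section
/- Let ι be a finite type, K ≥ 1, f : Finset ι → ℝ a normalized, monotone, submodular set function, and f_m : Finset ι → ℝ a set function with f_m(∅) = 0 and |f_m(S) − f(S)| ≤ ε for every S ⊆ ι, where ε ≥ 0. Let S_0 = ∅ and, for k = 1,…,K, S_k = S_{k-1} ∪ {a_k} where a_k ∉ S_{k-1} maximizes f_m(S_{k-1} ∪ {a}) over a ∉ S_{k-1} (greedy selection with respect to f_m). Then for every T ⊆ ι with |T| ≤ K, f_m(S_K) ≥ (1 − e⁻¹)·f(T) − (2K+1)·ε. -/
/-- Marginal gains of a monotone submodular set function decrease along unions. -/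
theorem marginal_union_le {ι : Type*} [DecidableEq ι] {f : Finset ι → ℝ}
    (hmono : ∀ S T : Finset ι, S ⊆ T → f S ≤ f T)
    (hsub : ∀ (S : Finset ι) (a b : ι), a ∉ S → b ∉ S → a ≠ b →
      f (insert a S) - f S ≥ f (insert a (insert b S)) - f (insert b S))
    (S U : Finset ι) (a : ι) :
    f (insert a (S ∪ U)) - f (S ∪ U) ≤ f (insert a S) - f S := by
  induction U using Finset.induction_on with
  | empty => simp
  | insert b U _ ih =>
    rw [Finset.union_insert]
    by_cases hb : b ∈ S ∪ U
    · rwa [Finset.insert_eq_of_mem hb]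
    by_cases ha : a ∈ insert b (S ∪ U)
    · rw [Finset.insert_eq_of_mem ha, sub_self]
      exact sub_nonneg.2 (hmono _ _ (Finset.subset_insert a S))
    · rw [Finset.mem_insert, not_or] at ha
      exact (hsub (S ∪ U) a b ha.2 hb ha.1).trans ih

/-- The gain from adjoining a set is at most the sum of the gains from its elements. -/
theorem union_sub_le_sum_marginal {ι : Type*} [DecidableEq ι] {f : Finset ι → ℝ}
    (hmono : ∀ S T : Finset ι, S ⊆ T → f S ≤ f T)
    (hsub : ∀ (S : Finset ι) (a b : ι), a ∉ S → b ∉ S → a ≠ b →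
      f (insert a S) - f S ≥ f (insert a (insert b S)) - f (insert b S))
    (S T : Finset ι) :
    f (S ∪ T) - f S ≤ ∑ t ∈ T, (f (insert t S) - f S) := by
  induction T using Finset.induction_on with
  | empty => simp
  | insert b T hb ih =>
    rw [Finset.union_insert, Finset.sum_insert hb]
    linarith [marginal_union_le hmono hsub S T b]

/-- A sequence contracting by a factor `r ∈ [0, 1]` up to an additive error `c ≥ 0` accumulates
at most `c` per step. -/
theorem le_pow_mul_add_of_contracting {D : ℕ → ℝ} {r c : ℝ} {K : ℕ} (hr0 : 0 ≤ r) (hr1 : r ≤ 1)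
    (hc : 0 ≤ c) (hD : ∀ k < K, D (k + 1) ≤ r * D k + c) {k : ℕ} (hk : k ≤ K) :
    D k ≤ r ^ k * D 0 + k * c := by
  induction k with
  | zero => simp
  | succ k ih =>
    have h_mul := mul_le_mul_of_nonneg_left (ih (by omega)) hr0
    have h_err : r * (k * c) ≤ k * c := mul_le_of_le_one_left (by positivity) hr1
    push_cast
    rw [pow_succ]
    linarith [hD k hk]

/-- **Deterministic core of Theorem 4.** If `f` is normalized, monotone and submodular,
and `f_m` uniformly `ε`-approximates `f` with `f_m ∅ = 0`, then the greedy algorithm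
run for `K` steps with respect to `f_m` returns a set `Sg K` with
`f_m (Sg K) ≥ (1 - e⁻¹)·f T - (2K+1)·ε` for every `T` with `|T| ≤ K`. -/
theorem greedy_near_optimal_of_approx
    {ι : Type*} [Fintype ι] [DecidableEq ι]
    (K : ℕ) (hK : 1 ≤ K)
    (f fm : Finset ι → ℝ) (ε : ℝ) (hε : 0 ≤ ε)
    (hnorm : f ∅ = 0)
    (hmono : ∀ S T : Finset ι, S ⊆ T → f S ≤ f T)
    (hsub : ∀ (S : Finset ι) (a b : ι), a ∉ S → b ∉ S → a ≠ b →
      f (insert a S) - f S ≥ f (insert a (insert b S)) - f (insert b S))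
    (hfm0 : fm ∅ = 0)
    (happrox : ∀ S : Finset ι, |fm S - f S| ≤ ε)
    (Sg : ℕ → Finset ι) (a : ℕ → ι)
    (hS0 : Sg 0 = ∅)
    (hstep : ∀ k, k < K → a k ∉ Sg k ∧ Sg (k + 1) = insert (a k) (Sg k) ∧
      ∀ b, b ∉ Sg k → fm (insert b (Sg k)) ≤ fm (insert (a k) (Sg k))) :
    ∀ T : Finset ι, T.card ≤ K →
      (1 - Real.exp (-1)) * f T - (2 * K + 1) * ε ≤ fm (Sg K) := by
  intro T hT
  have hKpos : (0 : ℝ) < K := by exact_mod_cast hK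
  have hK1 : (1 : ℝ) ≤ K := by exact_mod_cast hK
  have hfT : 0 ≤ f T := hnorm ▸ hmono ∅ T (Finset.empty_subset T)
  have hgap : ∀ k < K,
      f T - f (Sg (k + 1)) ≤ (1 - 1 / (K : ℝ)) * (f T - f (Sg k)) + 2 * ε := by
    intro k hk
    obtain ⟨-, hSucc, hmax⟩ := hstep k hk
    set g := f (Sg (k + 1)) - f (Sg k) + 2 * ε with hg
    have hSg : f (Sg k) ≤ f (Sg (k + 1)) :=
      hmono _ _ (hSucc ▸ Finset.subset_insert _ _)
    have hg0 : 0 ≤ g := by linarith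
    have hmarg : ∀ t ∈ T, f (insert t (Sg k)) - f (Sg k) ≤ g := by
      intro t _
      by_cases ht : t ∈ Sg k
      · rwa [Finset.insert_eq_of_mem ht, sub_self]
      · have hle := hmax t ht
        rw [← hSucc] at hle
        linarith [(abs_le.1 (happrox (insert t (Sg k)))).1,
          (abs_le.1 (happrox (Sg (k + 1)))).2]
    have hsum : f T - f (Sg k) ≤ K * g := by
      calc f T - f (Sg k) ≤ f (Sg k ∪ T) - f (Sg k) :=
            sub_le_sub_right (hmono _ _ Finset.subset_union_right) _
        _ ≤ ∑ t ∈ T, (f (insert t (Sg k)) - f (Sg k)) :=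
            union_sub_le_sum_marginal hmono hsub _ _
        _ ≤ T.card * g := by
            simpa using Finset.sum_le_card_nsmul T _ g hmarg
        _ ≤ K * g := mul_le_mul_of_nonneg_right (by exact_mod_cast hT) hg0
    have hdiv : 1 / (K : ℝ) * (f T - f (Sg k)) ≤ g := by
      rw [one_div_mul_eq_div, div_le_iff₀ hKpos]
      linarith
    linarith
  have hfinal := le_pow_mul_add_of_contracting (D := fun k => f T - f (Sg k))
    (sub_nonneg.2 ((div_le_one hKpos).2 hK1)) (sub_le_self 1 (by positivity))
    (by positivity) hgap le_rfl
  simp only [hS0, hnorm, sub_zero] at hfinal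
  have hexp := mul_le_mul_of_nonneg_right (Real.one_sub_div_pow_le_exp_neg hK1) hfT
  linarith [(abs_le.1 (happrox (Sg K))).1]
end
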